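/- Let H ∈ (1/2, 1), let λ_1, …, λ_p be pairwise distinct positive real numbers with p ≥ 2, and define γ(t) := ∑_{i=1}^{p} [λ_i^{2p−2H−2} / ∏_{j≠i}(λ_i² − λ_j²)] f_H(λ_i |t|) for t ∈ ℝ. Then ∑_{n=1}^{∞} |γ(n)| < ∞. (That is, although each fractional Ornstein–Uhlenbeck process FOU(λ_i,σ,H) with H > 1/2 has long memory, the iterated process FOU(λ_1,…,λ_p,σ,H) with p ≥ 2, whose auto-covariance is σ²H γ(t)/2, has short memory.) -/

import Mathlib

open MeasureTheory Real Filter Finset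

/-- `f_H^{(1)}(x) = e^{-x}(Γ(2H) − ∫_0^x e^s s^{2H−1} ds)`. -/
noncomputable def fH1 (H x : ℝ) : ℝ :=
  Real.exp (-x) * (Real.Gamma (2 * H) - ∫ s in (0:ℝ)..x, Real.exp s * s ^ (2 * H - 1))

/-- `f_H^{(2)}(x) = e^{x}(Γ(2H) − ∫_0^x e^{−s} s^{2H−1} ds)`. -/
noncomputable def fH2 (H x : ℝ) : ℝ :=
  Real.exp x * (Real.Gamma (2 * H) - ∫ s in (0:ℝ)..x, Real.exp (-s) * s ^ (2 * H - 1))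

/-- `f_H = f_H^{(1)} + f_H^{(2)}`. -/
noncomputable def fH (H x : ℝ) : ℝ := fH1 H x + fH2 H x

lemma hasDerivAt_exp_mul_rpow (c b b' : ℝ) (hb : b' = b - 1) {x : ℝ} (hx : 0 < x) :
    HasDerivAt (fun x => Real.exp (c * x) * x ^ b)
      (Real.exp (c * x) * (c * x ^ b + b * x ^ b')) x := by
  subst hb
  have h1 : HasDerivAt (fun x : ℝ => Real.exp (c * x)) (Real.exp (c * x) * c) x := by
    simpa using ((hasDerivAt_id x).const_mul c).exp
  exact (h1.mul (Real.hasDerivAt_rpow_const (p := b) (Or.inl hx.ne'))).congr_deriv (by ring)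

lemma monotoneOn_Ici_of_hasDerivAt_nonneg {f f' : ℝ → ℝ} {c : ℝ}
    (h : ∀ x, c ≤ x → HasDerivAt f (f' x) x) (h0 : ∀ x, c ≤ x → 0 ≤ f' x) :
    MonotoneOn f (Set.Ici c) := by
  refine monotoneOn_of_deriv_nonneg (convex_Ici c)
    (fun x hx => (h x hx).continuousAt.continuousWithinAt) ?_ ?_
  · intro x hx
    rw [interior_Ici] at hx
    exact (h x hx.le).differentiableAt.differentiableWithinAt
  · intro x hx
    rw [interior_Ici] at hx
    rw [(h x hx.le).deriv]
    exact h0 x hx.le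

lemma hasDerivAt_integral_exp_mul_rpow (c a : ℝ) (ha : 0 < a) (x : ℝ) :
    HasDerivAt (fun x => ∫ s in (0:ℝ)..x, Real.exp (c * s) * s ^ a)
      (Real.exp (c * x) * x ^ a) x := by
  have hc : Continuous fun s : ℝ => Real.exp (c * s) * s ^ a :=
    (by fun_prop : Continuous fun s : ℝ => Real.exp (c * s)).mul
      (Real.continuous_rpow_const ha.le)
  exact intervalIntegral.integral_hasDerivAt_right (hc.intervalIntegrable _ _)
    hc.stronglyMeasurable.stronglyMeasurableAtFilter hc.continuousAt

lemma tendsto_integral_exp_neg_mul_rpow (a : ℝ) (ha : 0 < a) :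
    Tendsto (fun x => ∫ s in (0:ℝ)..x, Real.exp (-1 * s) * s ^ a) atTop
      (nhds (Real.Gamma (a + 1))) := by
  rw [Real.Gamma_eq_integral (by linarith)]
  have h := intervalIntegral_tendsto_integral_Ioi (μ := volume) 0
    (Real.GammaIntegral_convergent (s := a + 1) (by linarith)) tendsto_id
  simpa using h

lemma tendsto_exp_neg_mul_rpow (b : ℝ) :
    Tendsto (fun x : ℝ => Real.exp (-1 * x) * x ^ b) atTop (nhds 0) := by
  simpa [mul_comm] using tendsto_rpow_mul_exp_neg_mul_atTop_nhds_zero b 1 one_pos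

lemma fH2_asymptotic {H : ℝ} (hH : H ∈ Set.Ioo (1/2 : ℝ) 1) :
    (fun x => fH2 H x - (x ^ (2 * H - 1) + (2 * H - 1) * x ^ (2 * H - 2)))
      =O[atTop] fun x => x ^ (2 * H - 3) := by
  obtain ⟨h1, h2⟩ := hH
  set a := 2 * H - 1 with hadef
  have ha : 0 < a := by linarith
  have ha1 : a < 1 := by linarith
  rw [show 2 * H - 2 = a - 1 by ring, show 2 * H - 3 = a - 2 by ring]
  set D : ℝ → ℝ := fun x => Real.Gamma (a + 1)
    - (∫ s in (0:ℝ)..x, Real.exp (-1 * s) * s ^ a)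
    - (Real.exp (-1 * x) * x ^ a + a * (Real.exp (-1 * x) * x ^ (a - 1))) with hD
  have hDd : ∀ x, 1 ≤ x → HasDerivAt D (Real.exp (-1 * x) * (a * (1 - a) * x ^ (a - 2))) x := by
    intro x hx
    have hx0 : 0 < x := by linarith
    refine HasDerivAt.congr_deriv (((hasDerivAt_integral_exp_mul_rpow (-1) a ha x).const_sub (Real.Gamma (a + 1))).sub
      ((hasDerivAt_exp_mul_rpow (-1) a (a - 1) rfl hx0).add
        ((hasDerivAt_exp_mul_rpow (-1) (a - 1) (a - 2) (by ring) hx0).const_mul a))) ?_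
    ring
  have hDt : Tendsto D atTop (nhds 0) := by
    simpa [hD] using ((tendsto_integral_exp_neg_mul_rpow a ha).const_sub (Real.Gamma (a + 1))).sub
      ((tendsto_exp_neg_mul_rpow a).add ((tendsto_exp_neg_mul_rpow (a - 1)).const_mul a))
  have hDm := monotoneOn_Ici_of_hasDerivAt_nonneg hDd (fun x hx => by
    have hx0 : 0 < x := by linarith
    have : 0 < 1 - a := by linarith
    positivity)
  have hEm := monotoneOn_Ici_of_hasDerivAt_nonneg (c := 1)
    (f := fun x => -(D x + a * (Real.exp (-1 * x) * x ^ (a - 2)))) (fun x hx =>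
      ((hDd x hx).add ((hasDerivAt_exp_mul_rpow (-1) (a - 2) (a - 3) (by ring)
        (by linarith)).const_mul a)).neg) (fun x hx => by
    have hx0 : 0 < x := by linarith
    have h3 : 0 < 2 - a := by linarith
    have : 0 ≤ Real.exp (-1 * x) * (a * a * x ^ (a - 2) + a * (2 - a) * x ^ (a - 3)) := by
      positivity
    linarith)
  have hEt : Tendsto (fun x => -(D x + a * (Real.exp (-1 * x) * x ^ (a - 2)))) atTop (nhds 0) := by
    simpa using (hDt.add ((tendsto_exp_neg_mul_rpow (a - 2)).const_mul a)).neg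
  refine Asymptotics.IsBigO.of_bound a ?_
  filter_upwards [eventually_ge_atTop 1] with x hx
  have hx0 : 0 < x := by linarith
  have hle : D x ≤ 0 := ge_of_tendsto hDt (by
    filter_upwards [eventually_ge_atTop x] with y hy
    exact hDm hx (hx.trans hy) hy)
  have hge : -(D x + a * (Real.exp (-1 * x) * x ^ (a - 2))) ≤ 0 := ge_of_tendsto hEt (by
    filter_upwards [eventually_ge_atTop x] with y hy
    exact hEm hx (hx.trans hy) hy)
  have hexp : Real.exp x * Real.exp (-1 * x) = 1 := by rw [← Real.exp_add]; simp
  have key : fH2 H x - (x ^ a + a * x ^ (a - 1)) = Real.exp x * D x := by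
    simp only [fH2, hD, ← hadef]
    rw [show 2 * H = a + 1 by rw [hadef]; ring]
    simp only [neg_one_mul] at hexp ⊢
    linear_combination (x ^ a + a * x ^ (a - 1)) * hexp
  have hp : 0 ≤ x ^ (a - 2) := by positivity
  rw [key, Real.norm_of_nonneg hp, Real.norm_eq_abs, abs_of_nonpos
    (mul_nonpos_of_nonneg_of_nonpos (Real.exp_pos x).le hle)]
  have := mul_le_mul_of_nonneg_left hge (Real.exp_pos x).le
  have e : Real.exp x * -(D x + a * (Real.exp (-1 * x) * x ^ (a - 2)))
    = -(Real.exp x * D x) - a * x ^ (a - 2) := by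
    linear_combination -(a * x ^ (a - 2)) * hexp
  rw [e] at this
  linarith

lemma fH1_asymptotic {H : ℝ} (hH : H ∈ Set.Ioo (1/2 : ℝ) 1) :
    (fun x => fH1 H x - (-x ^ (2 * H - 1) + (2 * H - 1) * x ^ (2 * H - 2)))
      =O[atTop] fun x => x ^ (2 * H - 3) := by
  obtain ⟨h1, h2⟩ := hH
  set a := 2 * H - 1 with hadef
  have ha : 0 < a := by linarith
  have ha1 : a < 1 := by linarith
  rw [show 2 * H - 2 = a - 1 by ring, show 2 * H - 3 = a - 2 by ring]
  set D : ℝ → ℝ := fun x => Real.Gamma (a + 1)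
    - (∫ s in (0:ℝ)..x, Real.exp (1 * s) * s ^ a)
    + (Real.exp (1 * x) * x ^ a - a * (Real.exp (1 * x) * x ^ (a - 1))) with hD
  have hDd : ∀ x, 4 ≤ x → HasDerivAt D (Real.exp (1 * x) * (a * (1 - a) * x ^ (a - 2))) x := by
    intro x hx
    have hx0 : 0 < x := by linarith
    refine HasDerivAt.congr_deriv (((hasDerivAt_integral_exp_mul_rpow 1 a ha x).const_sub (Real.Gamma (a + 1))).add
      ((hasDerivAt_exp_mul_rpow 1 a (a - 1) rfl hx0).sub
        ((hasDerivAt_exp_mul_rpow 1 (a - 1) (a - 2) (by ring) hx0).const_mul a))) ?_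
    ring
  have hDm := monotoneOn_Ici_of_hasDerivAt_nonneg hDd (fun x hx => by
    have hx0 : 0 < x := by linarith
    have : 0 < 1 - a := by linarith
    positivity)
  have hEm := monotoneOn_Ici_of_hasDerivAt_nonneg (c := 4)
    (f := fun x => Real.exp (1 * x) * x ^ (a - 2) - D x) (fun x hx =>
      (hasDerivAt_exp_mul_rpow 1 (a - 2) (a - 3) (by ring) (by linarith)).sub (hDd x hx))
    (fun x hx => by
    have hx0 : 0 < x := by linarith
    have hr : x ^ (a - 2) = x ^ (a - 3) * x := by
      rw [← Real.rpow_add_one hx0.ne']; ring_nf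
    have h3 : 0 ≤ x * (1 - a * (1 - a)) - (2 - a) := by
      nlinarith [sq_nonneg (2 * a - 1)]
    have : 0 ≤ Real.exp (1 * x) * (x ^ (a - 3) * (x * (1 - a * (1 - a)) - (2 - a))) := by
      positivity
    rw [hr]
    linarith)
  have hexpO : (fun x : ℝ => Real.exp (-1 * x)) =O[atTop] fun x => x ^ (a - 2) :=
    (isLittleO_exp_neg_mul_rpow_atTop one_pos _).isBigO
  set C : ℝ := |D 4| + |Real.exp (1 * 4) * 4 ^ (a - 2) - D 4| with hC
  refine Asymptotics.IsBigO.trans (g := fun x => C * Real.exp (-1 * x) + x ^ (a - 2)) ?_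
    ((hexpO.const_mul_left C).add (Asymptotics.isBigO_refl _ _))
  refine Asymptotics.IsBigO.of_bound 1 ?_
  filter_upwards [eventually_ge_atTop 4] with x hx
  have hx0 : 0 < x := by linarith
  have hlow : D 4 ≤ D x := hDm Set.self_mem_Ici hx hx
  have hupp := hEm Set.self_mem_Ici hx hx
  simp only at hupp
  have hexp : Real.exp (-1 * x) * Real.exp (1 * x) = 1 := by rw [← Real.exp_add]; simp
  have key : fH1 H x - (-x ^ a + a * x ^ (a - 1)) = Real.exp (-1 * x) * D x := by
    simp only [fH1, hD, ← hadef]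
    rw [show 2 * H = a + 1 by rw [hadef]; ring, ← neg_one_mul x]
    simp only [one_mul] at hexp ⊢
    linear_combination (-x ^ a + a * x ^ (a - 1)) * hexp
  have hp : 0 ≤ x ^ (a - 2) := by positivity
  have hC0 : 0 ≤ C := by positivity
  have hb1 : -C ≤ D x := by
    linarith [neg_abs_le (D 4), abs_nonneg (Real.exp (1 * 4) * 4 ^ (a - 2) - D 4)]
  have hb2 : D x ≤ C + Real.exp (1 * x) * x ^ (a - 2) := by
    linarith [neg_abs_le (Real.exp (1 * 4) * 4 ^ (a - 2) - D 4), abs_nonneg (D 4)]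
  have hm : 0 < Real.exp (-1 * x) := Real.exp_pos _
  have hb : 0 ≤ C * Real.exp (-1 * x) + x ^ (a - 2) := by positivity
  rw [key, one_mul, Real.norm_of_nonneg hb, Real.norm_eq_abs, abs_le]
  constructor
  · linarith [mul_le_mul_of_nonneg_left hb1 hm.le]
  · have e : Real.exp (-1 * x) * (C + Real.exp (1 * x) * x ^ (a - 2))
        = C * Real.exp (-1 * x) + x ^ (a - 2) := by
      linear_combination x ^ (a - 2) * hexp
    linarith [mul_le_mul_of_nonneg_left hb2 hm.le]

lemma fH_asymptotic {H : ℝ} (hH : H ∈ Set.Ioo (1/2 : ℝ) 1) :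
    (fun x => fH H x - 2 * (2 * H - 1) * x ^ (2 * H - 2)) =O[atTop] fun x => x ^ (2 * H - 3) := by
  refine ((fH1_asymptotic hH).add (fH2_asymptotic hH)).congr_left fun x => ?_
  rw [fH]
  ring

lemma sum_pow_div_prod_sub_eq_zero {p : ℕ} (hp : 2 ≤ p) {v : Fin p → ℝ}
    (hv : Function.Injective v) :
    ∑ i, v i ^ (p - 2) / ∏ j ∈ Finset.univ.erase i, (v i - v j) = 0 := by
  have h := Lagrange.coeff_eq_sum (s := Finset.univ) (v := v) hv.injOn
    (P := (Polynomial.X : Polynomial ℝ) ^ (p - 2)) (by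
      rw [Polynomial.degree_X_pow, Finset.card_univ, Fintype.card_fin]
      exact_mod_cast (by omega : p - 2 < p))
  simp only [Polynomial.eval_pow, Polynomial.eval_X] at h
  rw [← h, Finset.card_univ, Fintype.card_fin, Polynomial.coeff_X_pow, if_neg (by omega)]

theorem stmt_15 (H : ℝ) (hH : H ∈ Set.Ioo (1/2 : ℝ) 1) (p : ℕ) (hp : 2 ≤ p)
    (lam : Fin p → ℝ) (hpos : ∀ i, 0 < lam i) (hinj : Function.Injective lam)
    (γ : ℝ → ℝ)
    (hγ : ∀ t : ℝ, γ t = ∑ i,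
      (lam i ^ (2 * (p:ℝ) - 2 * H - 2) /
          ∏ j ∈ Finset.univ.erase i, (lam i ^ 2 - lam j ^ 2)) * fH H (lam i * |t|)) :
    Summable (fun n : ℕ => |γ ((n : ℝ) + 1)|) := by
  have hsq : Function.Injective fun i => lam i ^ 2 := fun i j hij =>
    hinj ((pow_left_inj₀ (hpos i).le (hpos j).le two_ne_zero).1 hij)
  have hzero := sum_pow_div_prod_sub_eq_zero hp hsq
  have hO : γ =O[atTop] fun t => t ^ (2 * H - 3) := by
    have hterm : ∀ i, (fun t => (lam i ^ (2 * (p:ℝ) - 2 * H - 2) /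
        ∏ j ∈ Finset.univ.erase i, (lam i ^ 2 - lam j ^ 2)) *
          (fH H (lam i * t) - 2 * (2 * H - 1) * (lam i * t) ^ (2 * H - 2)))
        =O[atTop] fun t => t ^ (2 * H - 3) := by
      intro i
      refine Asymptotics.IsBigO.const_mul_left ?_ _
      refine ((fH_asymptotic hH).comp_tendsto
        (tendsto_id.const_mul_atTop (hpos i))).trans ?_
      refine ((Asymptotics.isBigO_refl (fun t : ℝ => t ^ (2 * H - 3)) atTop).const_mul_left
        (lam i ^ (2 * H - 3))).congr' ?_ EventuallyEq.rfl
      filter_upwards [eventually_ge_atTop 0] with t ht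
      simp [Real.mul_rpow (hpos i).le ht]
    refine (Asymptotics.IsBigO.sum (s := Finset.univ) fun i _ => hterm i).congr' ?_
      EventuallyEq.rfl
    filter_upwards [eventually_ge_atTop 0] with t ht
    rw [hγ, abs_of_nonneg ht, Finset.sum_apply, ← sub_eq_zero, ← Finset.sum_sub_distrib]
    rw [← mul_zero (-(2 * (2 * H - 1) * t ^ (2 * H - 2))), ← hzero, Finset.mul_sum]
    refine Finset.sum_congr rfl fun i _ => ?_
    have hpow : lam i ^ (2 * (p:ℝ) - 2 * H - 2) * lam i ^ (2 * H - 2) = (lam i ^ 2) ^ (p - 2) := by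
      rw [← Real.rpow_add (hpos i), ← pow_mul, ← Real.rpow_natCast]
      congr 1
      push_cast [Nat.cast_sub hp]
      ring
    rw [Real.mul_rpow (hpos i).le ht, ← hpow]
    ring
  have hs : Summable fun n : ℕ => γ n :=
    summable_of_isBigO_nat (Real.summable_nat_rpow.2 (by linarith [hH.2]))
      (hO.comp_tendsto tendsto_natCast_atTop_atTop)
  have := (summable_nat_add_iff 1).2 hs.abs
  simpa using this
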